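/- Let P, Q be A-modules, let L : P → Q be a linear differential operator of order ≤ k, and let h : A → K be a K-point with I_h = ker h. Then there exists a unique K-multilinear map σ : (T*_h A)^k → Hom_K(P_h, Q_h) such that for all f₁, …, f_k ∈ A and all p ∈ P, σ(d_h(f₁), …, d_h(f_k))(ev_h(p)) = (δ_h(f₁)⋯δ_h(f_k)(ev_h ∘ L))(p). Moreover this σ is symmetric under permutations of its arguments, and for every f ∈ I_h and p ∈ P it satisfies σ(d_h(f), …, d_h(f))(ev_h(p)) = ev_h(L(f^k • p)). -/

import Mathlib

universe u

variable {K A : Type u} [CommRing K] [CommRing A] [Algebra K A]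

/-- Scalar multiplication by `f ∈ A` on an `A`-module, as a `K`-linear map. -/
def smulK (P : Type u) [AddCommGroup P] [Module A P] [Module K P] [IsScalarTower K A P]
    (f : A) : P →ₗ[K] P :=
  (LinearMap.lsmul A P f).restrictScalars K

section Delta

variable {P Q : Type u}
  [AddCommGroup P] [Module A P] [Module K P] [IsScalarTower K A P]
  [AddCommGroup Q] [Module A Q] [Module K Q] [IsScalarTower K A Q]

/-- `δ(f)F : P → Q`, `(δ(f)F)(p) = F(f•p) − f•F(p)`. -/
def deltaOp (f : A) (F : P →ₗ[K] Q) : P →ₗ[K] Q :=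
  F ∘ₗ smulK P f - smulK Q f ∘ₗ F

/-- Iterated `δ`: `deltaChain [f₁,…,f_j] F = δ(f₁)δ(f₂)⋯δ(f_j)F`. -/
def deltaChain (fs : List A) (F : P →ₗ[K] Q) : P →ₗ[K] Q :=
  fs.foldr deltaOp F

/-- `δ_h(f)G : P → W`, `(δ_h(f)G)(p) = G(f•p) − h(f)•G(p)`, for a `K`-point `h : A → K`. -/
def deltaH (h : A →ₐ[K] K) {W : Type u} [AddCommGroup W] [Module K W]
    (f : A) (G : P →ₗ[K] W) : P →ₗ[K] W :=
  G ∘ₗ smulK P f - h f • G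

/-- Iterated `δ_h`. -/
def deltaHChain (h : A →ₐ[K] K) {W : Type u} [AddCommGroup W] [Module K W]
    (fs : List A) (G : P →ₗ[K] W) : P →ₗ[K] W :=
  fs.foldr (deltaH h) G

end Delta

/-- `L : P → Q` is a linear differential operator of order `≤ k`:
`δ(f₀)δ(f₁)⋯δ(f_k)L = 0` for all `f₀, …, f_k ∈ A`. -/
def IsLDO {P Q : Type u}
    [AddCommGroup P] [Module A P] [Module K P] [IsScalarTower K A P]
    [AddCommGroup Q] [Module A Q] [Module K Q] [IsScalarTower K A Q]
    (k : ℕ) (L : P →ₗ[K] Q) : Prop :=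
  ∀ f : Fin (k + 1) → A, deltaChain (List.ofFn f) L = 0

/-- `I_h = ker h`, regarded as a `K`-submodule of `A`. -/
def kerPoint (h : A →ₐ[K] K) : Submodule K A := (RingHom.ker h).restrictScalars K

/-- The `K`-submodule of `I_h` corresponding to `I_h²`. -/
def kerPointSq (h : A →ₐ[K] K) : Submodule K (kerPoint h) :=
  Submodule.comap (kerPoint h).subtype ((RingHom.ker h ^ 2).restrictScalars K)

/-- The cotangent space `T*_h A = I_h/I_h²` at the `K`-point `h`. -/
abbrev CotangentAt (h : A →ₐ[K] K) := kerPoint h ⧸ kerPointSq h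

lemma sub_point_mem_ker (h : A →ₐ[K] K) (f : A) : f - algebraMap K A (h f) ∈ kerPoint h := by
  simp [kerPoint, RingHom.mem_ker]

/-- The differential `d_h(f) = [f − h(f)·1] ∈ T*_h A`. -/
def dPoint (h : A →ₐ[K] K) (f : A) : CotangentAt h :=
  Submodule.Quotient.mk ⟨f - algebraMap K A (h f), sub_point_mem_ker h f⟩

/-- The fibre `P_h = P/(I_h·P)` of an `A`-module `P` at the `K`-point `h`. -/
abbrev fiberAt (h : A →ₐ[K] K) (P : Type u) [AddCommGroup P] [Module A P] :=
  P ⧸ (RingHom.ker h • (⊤ : Submodule A P))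

/-- The canonical projection `ev_h : P → P_h` as a `K`-linear map. -/
def evAt (h : A →ₐ[K] K) (P : Type u) [AddCommGroup P] [Module A P] [Module K P]
    [IsScalarTower K A P] : P →ₗ[K] fiberAt h P :=
  (Submodule.mkQ (RingHom.ker h • (⊤ : Submodule A P))).restrictScalars K

namespace MultilinearMap

variable {R ι N : Type*} {M : ι → Type*} [CommRing R] [∀ i, AddCommGroup (M i)]
  [∀ i, Module R (M i)] [AddCommGroup N] [Module R N]

/-- A multilinear map vanishing as soon as one argument lies in the corresponding submodule takes
equal values on families that are congruent modulo these submodules. -/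
lemma eq_of_forall_sub_mem [Finite ι] (F : MultilinearMap R M N) (S : ∀ i, Submodule R (M i))
    (hF : ∀ v i, v i ∈ S i → F v = 0) {v w : ∀ i, M i} (hvw : ∀ i, v i - w i ∈ S i) :
    F v = F w := by
  classical
  cases nonempty_fintype ι
  have key : ∀ s : Finset ι, F (s.piecewise v w) = F w := by
    intro s
    induction s using Finset.induction_on with
    | empty => simp
    | insert a s ha ih =>
      rw [← ih, Finset.piecewise_insert, ← sub_eq_zero]
      have hw : s.piecewise v w = Function.update (s.piecewise v w) a (w a) := by
        simp [Finset.piecewise_eq_of_notMem s v w ha]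
      conv_lhs => rw [hw]
      rw [Function.update_idem, ← F.map_update_sub]
      exact hF _ a (by simpa using hvw a)
  simpa using key Finset.univ

/-- A multilinear map vanishing as soon as one argument lies in the corresponding submodule
descends to the quotients. -/
lemma exists_quotient_lift [Finite ι] (F : MultilinearMap R M N) (S : ∀ i, Submodule R (M i))
    (hF : ∀ v i, v i ∈ S i → F v = 0) :
    ∃ F' : MultilinearMap R (fun i => M i ⧸ S i) N,
      ∀ v : ∀ i, M i, F' (fun i => Submodule.Quotient.mk (v i)) = F v := by
  have hmk : ∀ i (x : M i ⧸ S i), Submodule.Quotient.mk x.out = x := fun i x => Quotient.out_eq x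
  have hwd : ∀ {v w : ∀ i, M i}, (∀ i, (Submodule.Quotient.mk (v i) : M i ⧸ S i) =
      Submodule.Quotient.mk (w i)) → F v = F w := fun hvw =>
    F.eq_of_forall_sub_mem S hF fun i => (Submodule.Quotient.eq (S i)).1 (hvw i)
  have hup : ∀ [DecidableEq ι] (m : ∀ i, M i ⧸ S i) (i : ι) (x : M i),
      F (fun j => (Function.update m i (Submodule.Quotient.mk x) j).out) =
        F (Function.update (fun j => (m j).out) i x) := by
    intro _ m i x
    refine hwd fun j => ?_
    rw [hmk]
    obtain rfl | hj := eq_or_ne j i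
    · simp
    · simp [hj, hmk]
  refine ⟨{ toFun := fun v => F fun i => (v i).out
            map_update_add' := ?_
            map_update_smul' := ?_ }, fun v => hwd fun i => hmk i _⟩
  · intro _ m i x y
    obtain ⟨x, rfl⟩ := Submodule.Quotient.mk_surjective _ x
    obtain ⟨y, rfl⟩ := Submodule.Quotient.mk_surjective _ y
    rw [← Submodule.Quotient.mk_add, hup, hup, hup, F.map_update_add]
  · intro _ m i c x
    obtain ⟨x, rfl⟩ := Submodule.Quotient.mk_surjective _ x
    rw [← Submodule.Quotient.mk_smul, hup, hup, F.map_update_smul]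

end MultilinearMap

section PrincipalSymbol

variable {P Q W : Type u}
  [AddCommGroup P] [Module A P] [Module K P] [IsScalarTower K A P]
  [AddCommGroup Q] [Module A Q] [Module K Q] [IsScalarTower K A Q]
  [AddCommGroup W] [Module K W]

lemma deltaHChain_apply (h : A →ₐ[K] K) (fs : List A) (G : P →ₗ[K] W) (p : P) :
    deltaHChain h fs G p = G ((fs.map fun f => f - algebraMap K A (h f)).prod • p) := by
  induction fs generalizing p with
  | nil => simp [deltaHChain]
  | cons f fs ih =>
    have hcons : deltaHChain h (f :: fs) G = deltaH h f (deltaHChain h fs G) := rfl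
    simp only [hcons, deltaH, smulK, LinearMap.sub_apply, LinearMap.comp_apply,
      LinearMap.smul_apply, LinearMap.coe_restrictScalars, LinearMap.lsmul_apply, ih,
      List.map_cons, List.prod_cons]
    rw [← map_smul, ← map_sub, ← algebraMap_smul A (h f), smul_smul, smul_smul, ← sub_smul]
    congr 2
    ring

lemma deltaHChain_ofFn_apply (h : A →ₐ[K] K) {n : ℕ} (f : Fin n → A) (G : P →ₗ[K] W) (p : P) :
    deltaHChain h (List.ofFn f) G p = G ((∏ i, (f i - algebraMap K A (h (f i)))) • p) := by
  rw [deltaHChain_apply, List.map_ofFn, List.prod_ofFn]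
  rfl

lemma evAt_smul (h : A →ₐ[K] K) (f : A) (q : Q) : evAt h Q (f • q) = h f • evAt h Q q := by
  rw [← map_smul, ← sub_eq_zero, ← map_sub, ← algebraMap_smul A (h f) q, ← sub_smul]
  exact (Submodule.Quotient.mk_eq_zero _).2
    (Submodule.smul_mem_smul (sub_point_mem_ker h f) Submodule.mem_top)

lemma evAt_surjective (h : A →ₐ[K] K) : Function.Surjective (evAt h P) :=
  fun x => Submodule.Quotient.mk_surjective (RingHom.ker h • (⊤ : Submodule A P)) x

lemma deltaHChain_evAt_comp (h : A →ₐ[K] K) (fs : List A) (F : P →ₗ[K] Q) :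
    deltaHChain h fs (evAt h Q ∘ₗ F) = evAt h Q ∘ₗ deltaChain fs F := by
  induction fs with
  | nil => rfl
  | cons f fs ih =>
    change deltaH h f (deltaHChain h fs _) = evAt h Q ∘ₗ deltaOp f (deltaChain fs F)
    rw [ih]
    ext p
    simp [deltaH, deltaOp, smulK, evAt_smul]

lemma forall_pow_smul_eq_zero (I : Ideal A) (n : ℕ) (G : P →ₗ[K] W)
    (hG : ∀ g : Fin n → A, (∀ i, g i ∈ I) → ∀ p, G ((∏ i, g i) • p) = 0) :
    ∀ a ∈ I ^ n, ∀ p, G (a • p) = 0 := by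
  induction n generalizing G with
  | zero =>
    intro a _ p
    simpa using hG Fin.elim0 (fun i => i.elim0) (a • p)
  | succ n ih =>
    intro a ha p
    rw [pow_succ'] at ha
    induction ha using Submodule.mul_induction_on' with
    | mem_mul_mem b hb c hc =>
      have := ih (G ∘ₗ smulK P b) (fun g hg q => by
        have := hG (Fin.cons b g) (Fin.cases hb hg) q
        rw [Fin.prod_cons, mul_smul] at this
        exact this) c hc p
      rw [mul_smul]
      exact this
    | add x _ y _ hx hy => rw [add_smul, map_add, hx, hy, add_zero]

lemma IsLDO.evAt_pow_smul_eq_zero (h : A →ₐ[K] K) {k : ℕ} {L : P →ₗ[K] Q}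
    (hL : IsLDO (K := K) (A := A) k L) {a : A} (ha : a ∈ RingHom.ker h ^ (k + 1)) (p : P) :
    evAt h Q (L (a • p)) = 0 := by
  refine forall_pow_smul_eq_zero (RingHom.ker h) (k + 1) (evAt h Q ∘ₗ L) (fun g hg p => ?_) a ha p
  have := deltaHChain_ofFn_apply h g (evAt h Q ∘ₗ L) p
  rw [deltaHChain_evAt_comp, hL g] at this
  simpa [fun i => (RingHom.mem_ker).1 (hg i)] using this.symm

lemma dPoint_of_mem (h : A →ₐ[K] K) (x : kerPoint h) :
    dPoint h (x : A) = Submodule.Quotient.mk x := by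
  have hx : h x = 0 := x.2
  simp [dPoint, hx]

lemma dPoint_surjective (h : A →ₐ[K] K) : Function.Surjective (dPoint h) := by
  intro x
  obtain ⟨x, rfl⟩ := Submodule.Quotient.mk_surjective _ x
  exact ⟨x, dPoint_of_mem h x⟩

/-- `(g₁, …, g_k) ↦ (p ↦ G(g₁⋯g_k • p))` for `g₁, …, g_k ∈ I_h`. -/
def prodSymbol (h : A →ₐ[K] K) (k : ℕ) (G : P →ₗ[K] W) :
    MultilinearMap K (fun _ : Fin k => kerPoint h) (P →ₗ[K] W) :=
  (LinearMap.compRight K G ∘ₗ (Algebra.lsmul K K P).toLinearMap).compMultilinearMap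
    ((MultilinearMap.mkPiAlgebra K (Fin k) A).compLinearMap fun _ => (kerPoint h).subtype)

lemma prodSymbol_apply (h : A →ₐ[K] K) {k : ℕ} (G : P →ₗ[K] W) (g : Fin k → kerPoint h) (p : P) :
    prodSymbol h k G g p = G ((∏ i, (g i : A)) • p) := by
  simp [prodSymbol]

lemma prod_mem_ker_pow (h : A →ₐ[K] K) {k : ℕ} (g : Fin k → kerPoint h) :
    ∏ i, (g i : A) ∈ RingHom.ker h ^ k := by
  simpa using Ideal.prod_mem_prod (s := Finset.univ) (I := fun _ : Fin k => RingHom.ker h)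
    fun i _ => (g i).2

lemma prod_mem_ker_pow_succ (h : A →ₐ[K] K) {k : ℕ} (g : Fin k → kerPoint h) (i : Fin k)
    (hi : g i ∈ kerPointSq h) : ∏ i, (g i : A) ∈ RingHom.ker h ^ (k + 1) := by
  obtain _ | k := k
  · exact i.elim0
  · rw [Fin.prod_univ_succAbove _ i, show k + 1 + 1 = 2 + k by omega, pow_add]
    exact Ideal.mul_mem_mul hi (prod_mem_ker_pow h fun j => g (i.succAbove j))

end PrincipalSymbol

/-- Existence and uniqueness of the principal symbol of a linear differential operator `L` of
order `≤ k` at a `K`-point `h`: the unique `K`-multilinear map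
`σ : (T*_h A)^k → Hom_K(P_h, Q_h)` with
`σ(d_h f₁, …, d_h f_k)(ev_h p) = (δ_h(f₁)⋯δ_h(f_k)(ev_h ∘ L))(p)`; moreover `σ` is symmetric
and satisfies `σ(d_h f, …, d_h f)(ev_h p) = ev_h (L (f^k • p))` for `f ∈ I_h`. -/
theorem principalSymbol_at_point (h : A →ₐ[K] K) (k : ℕ)
    {P Q : Type u}
    [AddCommGroup P] [Module A P] [Module K P] [IsScalarTower K A P]
    [AddCommGroup Q] [Module A Q] [Module K Q] [IsScalarTower K A Q]
    (L : P →ₗ[K] Q) (hL : IsLDO (K := K) (A := A) k L) :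
    ∃ σ : MultilinearMap K (fun _ : Fin k => CotangentAt h) (fiberAt h P →ₗ[K] fiberAt h Q),
      (∀ (f : Fin k → A) (p : P),
        σ (fun i => dPoint h (f i)) (evAt h P p)
          = deltaHChain h (List.ofFn f) (evAt h Q ∘ₗ L) p) ∧
      (∀ σ' : MultilinearMap K (fun _ : Fin k => CotangentAt h) (fiberAt h P →ₗ[K] fiberAt h Q),
        (∀ (f : Fin k → A) (p : P),
          σ' (fun i => dPoint h (f i)) (evAt h P p)
            = deltaHChain h (List.ofFn f) (evAt h Q ∘ₗ L) p) → σ' = σ) ∧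
      (∀ (e : Equiv.Perm (Fin k)) (v : Fin k → CotangentAt h),
        σ (fun i => v (e i)) = σ v) ∧
      (∀ f ∈ RingHom.ker h, ∀ p : P,
        σ (fun _ => dPoint h f) (evAt h P p) = evAt h Q (L (f ^ k • p))) := by
  obtain ⟨N, hN⟩ := (prodSymbol h k (evAt h Q ∘ₗ L)).exists_quotient_lift
    (fun _ => kerPointSq h) (fun g i hi => by
      ext p
      rw [prodSymbol_apply]
      exact hL.evAt_pow_smul_eq_zero h (prod_mem_ker_pow_succ h g i hi) p)
  have hker : ∀ v, (RingHom.ker h • (⊤ : Submodule A P)).restrictScalars K ≤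
      LinearMap.ker (N v) := by
    intro v x hx
    choose g hg using fun i => Submodule.Quotient.mk_surjective _ (v i)
    obtain rfl : (fun i => Submodule.Quotient.mk (g i)) = v := funext hg
    rw [LinearMap.mem_ker, hN]
    rw [Submodule.restrictScalars_mem] at hx
    induction hx using Submodule.smul_induction_on' with
    | smul a ha p _ =>
      rw [prodSymbol_apply, smul_smul]
      exact hL.evAt_pow_smul_eq_zero h
        (by rw [pow_succ]; exact Ideal.mul_mem_mul (prod_mem_ker_pow h g) ha) p
    | add x hx y hy ihx ihy => rw [map_add, ihx, ihy, add_zero]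
  let lift : (Fin k → CotangentAt h) → (fiberAt h P →ₗ[K] fiberAt h Q) := fun v =>
    Submodule.liftQ _ (N v) (hker v) ∘ₗ
      (Submodule.Quotient.restrictScalarsEquiv K (RingHom.ker h • (⊤ : Submodule A P))).symm
  have hlift : ∀ v p, lift v (evAt h P p) = N v p := fun v p => rfl
  have hext : ∀ {F G : fiberAt h P →ₗ[K] fiberAt h Q},
      (∀ p, F (evAt h P p) = G (evAt h P p)) → F = G := fun hFG =>
    LinearMap.ext fun x => by
      obtain ⟨p, rfl⟩ := evAt_surjective h x
      exact hFG p
  let σ : MultilinearMap K (fun _ : Fin k => CotangentAt h) (fiberAt h P →ₗ[K] fiberAt h Q) :=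
    { toFun := lift
      map_update_add' := fun m i x y => hext fun p => by
        simp only [LinearMap.add_apply, hlift, N.map_update_add]
      map_update_smul' := fun m i c x => hext fun p => by
        simp only [LinearMap.smul_apply, hlift, N.map_update_smul] }
  have hσ : ∀ (f : Fin k → A) (p : P), σ (fun i => dPoint h (f i)) (evAt h P p)
      = evAt h Q (L ((∏ i, (f i - algebraMap K A (h (f i)))) • p)) := fun f p =>
    (congrArg (fun F : P →ₗ[K] fiberAt h Q => F p) (hN _)).trans (prodSymbol_apply h _ _ p)
  refine ⟨σ, fun f p => ?_, fun σ' hσ' => ?_, fun e v => ?_, fun f hf p => ?_⟩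
  · rw [hσ, deltaHChain_ofFn_apply]
    rfl
  · ext1 v
    choose f hf using fun i => dPoint_surjective h (v i)
    obtain rfl : (fun i => dPoint h (f i)) = v := funext hf
    refine hext fun p => ?_
    rw [hσ', hσ, deltaHChain_ofFn_apply]
    rfl
  · choose f hf using fun i => dPoint_surjective h (v i)
    obtain rfl : (fun i => dPoint h (f i)) = v := funext hf
    refine hext fun p => ?_
    rw [hσ f, hσ fun i => f (e i), Equiv.prod_comp e fun i => f i - algebraMap K A (h (f i))]
  · rw [hσ]
    simp [(RingHom.mem_ker).1 hf]
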